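/- arXiv:1611.08370 — 4 statements merged into one kernel-verified Lean document; each statement's English description precedes it below -/
import Mathlib

section
/- Let θ ∈ ℝ with |θ| < 2π/n and set q = e^{iθ}. Then for every word w ∈ FreeGroup (Fin (n−1)), every eigenvalue α ∈ ℂ of β_{n,q}(w) (i.e. every root of det(x·I_n − β_{n,q}(w))) satisfies |α| = 1. Consequently the braid zeta function satisfies the analogue of the Riemann hypothesis: every s ∈ ℂ with det(I_n − e^{−s}·β_{n,q}(w)) = 0 satisfies Re(s) = 0. -/
open Matrix

/-- The (unreduced) Burau matrix `B_{i+1} = I_i ⊕ [[1−q, 1], [q, 0]] ⊕ I_{n-i-2}`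
(the 2×2 block sits in rows/columns `i`, `i+1`, zero-based). -/
noncomputable def burauMatrix (n : ℕ) (q : ℂ) (i : Fin (n - 1)) :
    Matrix (Fin n) (Fin n) ℂ := fun j k =>
  if (j : ℕ) = i ∧ (k : ℕ) = i then 1 - q
  else if (j : ℕ) = i ∧ (k : ℕ) = (i : ℕ) + 1 then 1
  else if (j : ℕ) = (i : ℕ) + 1 ∧ (k : ℕ) = i then q
  else if (j : ℕ) = (i : ℕ) + 1 ∧ (k : ℕ) = (i : ℕ) + 1 then 0
  else if j = k then 1 else 0

/-- The reduced Burau matrix `B^r_{i+1}` (zero-based generator index `i`): it agrees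
with the identity except in row `i`, where the entries at columns `i−1, i, i+1`
are `q, −q, 1` respectively. -/
noncomputable def rBurauMatrix (n : ℕ) (q : ℂ) (i : Fin (n - 1)) :
    Matrix (Fin (n - 1)) (Fin (n - 1)) ℂ := fun j k =>
  if (j : ℕ) = i then
    if (k : ℕ) + 1 = i then q
    else if (k : ℕ) = i then -q
    else if (k : ℕ) = (i : ℕ) + 1 then 1
    else 0
  else if j = k then 1 else 0



/-- Invariant Hermitian form (on the whole space). -/
noncomputable def sqForm (n : ℕ) (t t' : ℂ) : Matrix (Fin n) (Fin n) ℂ := fun j k =>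
  (t - t') + (if (k : ℕ) < j + 1 then 2 * t' else 0) - (if (k : ℕ) < j then 2 * t else 0)

lemma burau_eq (n : ℕ) (q : ℂ) (i : Fin (n - 1)) (a b : Fin n) (ha : (a : ℕ) = i)
    (hb : (b : ℕ) = i + 1) :
    burauMatrix n q i = 1 + vecMulVec (Pi.single b 1 - Pi.single a 1)
      (Pi.single a q - Pi.single b 1) := by
  have hab : a ≠ b := by intro h; rw [h] at ha; omega
  ext j k
  have e1 : ((j : ℕ) = i) ↔ j = a := by rw [← ha, Fin.ext_iff]
  have e2 : ((j : ℕ) = i + 1) ↔ j = b := by rw [← hb, Fin.ext_iff]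
  have e3 : ((k : ℕ) = i) ↔ k = a := by rw [← ha, Fin.ext_iff]
  have e4 : ((k : ℕ) = i + 1) ↔ k = b := by rw [← hb, Fin.ext_iff]
  simp only [burauMatrix, e1, e2, e3, e4, Matrix.add_apply, Matrix.one_apply, vecMulVec_apply,
    Pi.sub_apply, Pi.single_apply]
  by_cases h1 : j = a
  · subst h1
    by_cases h3 : k = j
    · subst h3; simp [hab]; try ring
    · by_cases h4 : k = b
      · subst h4; simp [hab, hab.symm]
      · simp [h3, h4, hab, Ne.symm h3]
  · by_cases h2 : j = b
    · subst h2
      by_cases h3 : k = a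
      · subst h3; simp [hab, hab.symm]
      · by_cases h4 : k = j
        · subst h4; simp [h3]
        · simp [h3, h4, hab, hab.symm, Ne.symm h4]
    · simp [h1, h2]

lemma u_form (n : ℕ) (t t' q : ℂ) (htt : t * t' = 1) (hq : q = t * t) (a b : Fin n)
    (hb : (b : ℕ) = a + 1) :
    (Pi.single b 1 - Pi.single a 1 : Fin n → ℂ) ᵥ* sqForm n t t' =
      (-2 * t') • (Pi.single a q - Pi.single b 1 : Fin n → ℂ) := by
  have hab : a ≠ b := by intro h; rw [h] at hb; omega
  ext k
  rw [Matrix.sub_vecMul]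
  simp only [Pi.sub_apply, Matrix.single_one_vecMul, Pi.smul_apply, smul_eq_mul, sqForm, Matrix.row]
  have e : t' * q = t := by rw [hq]; linear_combination t * htt
  rcases lt_trichotomy (k : ℕ) a with h | h | h
  · have h1 : k ≠ a := by rintro rfl; omega
    have h2 : k ≠ b := by rintro rfl; omega
    simp [h1, h2, show (k : ℕ) < b + 1 by omega, show (k : ℕ) < b by omega,
      show (k : ℕ) < a + 1 by omega, h]
  · have h1 : k = a := Fin.ext h
    subst h1
    simp [hab, show (k : ℕ) < b + 1 by omega, show (k : ℕ) < b by omega]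
    linear_combination -2 * e
  · have h1 : k ≠ a := by rintro rfl; omega
    by_cases h2 : k = b
    · subst h2
      simp [h1, show ¬ (k : ℕ) < a + 1 by omega, show ¬ (k : ℕ) < a by omega]
    · have : (k : ℕ) ≠ b := fun h' => h2 (Fin.ext h')
      simp [h1, h2, show ¬ (k : ℕ) < a + 1 by omega, show ¬ (k : ℕ) < a by omega,
        show ¬ (k : ℕ) < b + 1 by omega, show ¬ (k : ℕ) < b by omega]

lemma sqForm_herm (n : ℕ) (t t' : ℂ) (ht : star t = t') : (sqForm n t t')ᴴ = sqForm n t t' := by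
  have ht' : star t' = t := by rw [← ht, star_star]
  ext j k
  simp only [conjTranspose_apply, sqForm, star_sub, star_add, apply_ite star, star_mul', ht, ht',
    star_zero, star_ofNat]
  rcases lt_trichotomy (k : ℕ) j with h | h | h
  · simp [h, show (k : ℕ) < j + 1 by omega, show ¬ (j : ℕ) < k + 1 by omega,
      show ¬ (j : ℕ) < k by omega]
    ring
  · simp [h]; ring
  · simp [h, show (j : ℕ) < k + 1 by omega, show ¬ (k : ℕ) < j + 1 by omega,
      show ¬ (k : ℕ) < j by omega]
    ring

lemma burau_inv (n : ℕ) (t t' q : ℂ) (htt : t * t' = 1) (hq : q = t * t) (ht : star t = t')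
    (i : Fin (n - 1)) :
    (burauMatrix n q i)ᴴ * sqForm n t t' * burauMatrix n q i = sqForm n t t' := by
  have hi := i.2
  obtain ⟨a, ha⟩ : ∃ a : Fin n, (a : ℕ) = i := ⟨⟨i, by omega⟩, rfl⟩
  obtain ⟨b, hb⟩ : ∃ b : Fin n, (b : ℕ) = i + 1 := ⟨⟨i + 1, by omega⟩, rfl⟩
  have hab : a ≠ b := by intro h; rw [h] at ha; omega
  rw [burau_eq n q i a b ha hb]
  have hu := u_form n t t' q htt hq a b (by omega)
  set u : Fin n → ℂ := Pi.single b 1 - Pi.single a 1 with hudef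
  set l : Fin n → ℂ := Pi.single a q - Pi.single b 1 with hl
  have hsu : star u = u := by
    ext k
    simp only [hudef, Pi.star_apply, Pi.sub_apply, Pi.single_apply, star_sub]
    split_ifs <;> simp
  have ht' : star t' = t := by rw [← ht, star_star]
  have hMu : sqForm n t t' *ᵥ u = (-2 * t) • star l := by
    have := congrArg star hu
    rw [Matrix.star_vecMul, sqForm_herm n t t' ht, hsu] at this
    rw [this, star_smul]; simp [ht']
  have hlu : l ⬝ᵥ u = -q - 1 := by
    simp [hl, hudef, hab, hab.symm]
    try ring
  have h1 : (1 + vecMulVec u l)ᴴ = 1 + vecMulVec (star l) u := by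
    rw [conjTranspose_add, conjTranspose_one, conjTranspose_vecMulVec, hsu]
  have e : t' * q = t := by rw [hq]; linear_combination t * htt
  rw [h1, add_mul, one_mul, vecMulVec_mul, hu, mul_add, mul_one, add_mul, mul_vecMulVec, hMu,
    vecMulVec_mul_vecMulVec, smul_dotProduct, hlu]
  ext j k
  simp only [Matrix.add_apply, vecMulVec_apply, Pi.smul_apply, smul_eq_mul]
  linear_combination (2 * star l j * l k) * e

lemma burau_one (n : ℕ) (q : ℂ) (i : Fin (n - 1)) :
    (1 : Fin n → ℂ) ᵥ* burauMatrix n q i = 1 := by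
  have hi := i.2
  rw [burau_eq n q i ⟨i, by omega⟩ ⟨i + 1, by omega⟩ rfl rfl, vecMul_add, vecMul_one,
    vecMul_vecMulVec]
  simp

lemma real_ineq (n : ℕ) (hn : 2 ≤ n) (a : ℕ → ℝ) (h0 : a 0 = 0) (han : a n = 0) :
    0 ≤ ∑ j ∈ Finset.range n,
      (Real.cos (Real.pi / n) * (a (j + 1) ^ 2 + a j ^ 2) - 2 * a j * a (j + 1)) := by
  have hn0 : (0 : ℝ) < n := by exact_mod_cast (by omega : 0 < n)
  set p : ℕ → ℝ := fun k => Real.sin (k * (Real.pi / n)) with hp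
  set γ := Real.cos (Real.pi / n) with hγ
  have hpos : ∀ k : ℕ, 1 ≤ k → k < n → 0 < p k := by
    intro k h1 h2
    apply Real.sin_pos_of_pos_of_lt_pi
    · have : (0 : ℝ) < k := by exact_mod_cast h1
      have := Real.pi_pos
      positivity
    · have : (k : ℝ) < n := by exact_mod_cast h2
      rw [mul_div_assoc', div_lt_iff₀ hn0, mul_comm]
      exact mul_lt_mul_of_pos_left this Real.pi_pos
  have hrec : ∀ k : ℕ, p (k + 2) = 2 * γ * p (k + 1) - p k := by
    intro k
    simp only [hp, hγ]
    have e1 : ((k + 2 : ℕ) : ℝ) * (Real.pi / n) = ((k + 1 : ℕ) : ℝ) * (Real.pi / n) + Real.pi / n := by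
      push_cast; ring
    have e2 : (k : ℝ) * (Real.pi / n) = ((k + 1 : ℕ) : ℝ) * (Real.pi / n) - Real.pi / n := by
      push_cast; ring
    rw [e1, e2, Real.sin_add, Real.sin_sub]; ring
  have hp0 : p 0 = 0 := by simp [hp]
  have hpn : p n = 0 := by
    simp only [hp]
    rw [mul_div_cancel₀ _ hn0.ne', Real.sin_pi]
  have key : ∀ m : ℕ, m + 1 < n → (p (m + 2) / p (m + 1) - γ) * a (m + 1) ^ 2 ≤
      ∑ j ∈ Finset.range (m + 1), (γ * (a (j + 1) ^ 2 + a j ^ 2) - 2 * a j * a (j + 1)) := by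
    intro m
    induction m with
    | zero =>
      intro h
      have := hpos 1 le_rfl h
      have e : p 2 / p 1 = 2 * γ := by
        rw [div_eq_iff this.ne']; have := hrec 0; rw [hp0] at this; simpa using this
      simp [h0, e]
      apply le_of_eq; ring
    | succ m ih =>
      intro h
      have h1 := hpos (m + 1) (by omega) (by omega)
      have h2 := hpos (m + 2) (by omega) (by omega)
      rw [Finset.sum_range_succ]
      have := ih (by omega)
      have e : p (m + 1 + 2) / p (m + 1 + 1) = 2 * γ - p (m + 1) / p (m + 2) := by
        rw [hrec (m + 1)]; field_simp
      rw [e]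
      have hsq : 0 ≤ p (m + 2) / p (m + 1) * (a (m + 1) - p (m + 1) / p (m + 2) * a (m + 2)) ^ 2 := by
        positivity
      have hsq' : p (m + 2) / p (m + 1) * (a (m + 1) - p (m + 1) / p (m + 2) * a (m + 2)) ^ 2
          = p (m + 2) / p (m + 1) * a (m + 1) ^ 2 - 2 * a (m + 1) * a (m + 2)
            + p (m + 1) / p (m + 2) * a (m + 2) ^ 2 := by
        field_simp
        ring
      rw [hsq'] at hsq
      have e3 : m + 1 + 1 = m + 2 := rfl
      rw [e3]
      nlinarith
  obtain ⟨m, rfl⟩ : ∃ m, n = m + 2 := ⟨n - 2, by omega⟩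
  have := key m (by omega)
  rw [Finset.sum_range_succ]
  rw [hpn, zero_div] at this
  have e3 : m + 1 + 1 = m + 2 := rfl
  rw [e3, han]
  linarith

lemma real_ineq_strict (n : ℕ) (hn : 2 ≤ n) (κ : ℝ) (hκ : Real.cos (Real.pi / n) < κ)
    (a : ℕ → ℝ) (h0 : a 0 = 0) (han : a n = 0) (m : ℕ) (hm : m < n) (ham : a m ≠ 0) :
    0 < ∑ j ∈ Finset.range n, (κ * (a (j + 1) ^ 2 + a j ^ 2) - 2 * a j * a (j + 1)) := by
  refine (real_ineq n hn a h0 han).trans_lt (Finset.sum_lt_sum ?_ ⟨m, Finset.mem_range.2 hm, ?_⟩)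
  · intro j _
    have : 0 ≤ a (j + 1) ^ 2 + a j ^ 2 := by positivity
    nlinarith
  · have : 0 < a (m + 1) ^ 2 + a m ^ 2 := by positivity
    nlinarith

lemma form_pos (n : ℕ) (hn : 2 ≤ n) (t t' : ℂ) (htt : t * t' = 1) (ht : star t = t')
    (hre : Real.cos (Real.pi / n) < t.re) (x : Fin n → ℂ) (hx : x ≠ 0) (hs : ∑ k, x k = 0) :
    0 < (star x ⬝ᵥ (sqForm n t t' *ᵥ x)).re := by
  set C : ℕ → ℂ := fun m => ∑ k : Fin n, if (k : ℕ) < m then x k else 0 with hC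
  have hC0 : C 0 = 0 := by simp [hC]
  have hCn : C n = 0 := by simp [hC, hs]
  have hCs : ∀ j : Fin n, C (j + 1) = C j + x j := by
    intro j
    have : x j = ∑ k : Fin n, if k = j then x k else 0 := by simp
    rw [this]
    simp only [hC]
    rw [← Finset.sum_add_distrib]
    refine Finset.sum_congr rfl fun k _ => ?_
    rcases lt_trichotomy (k : ℕ) j with h | h | h
    · have : k ≠ j := by rintro rfl; omega
      simp [h, this, show (k : ℕ) < j + 1 by omega]
    · have : k = j := Fin.ext h
      simp [this]
    · have h' : k ≠ j := by rintro rfl; omega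
      simp [h', show ¬ (k : ℕ) < j + 1 by omega, show ¬ (k : ℕ) < j by omega]
  have hM : ∀ j : Fin n, (sqForm n t t' *ᵥ x) j = 2 * (t' * C (j + 1) - t * C j) := by
    intro j
    have : (sqForm n t t' *ᵥ x) j = (t - t') * ∑ k, x k + 2 * t' * C (j + 1) - 2 * t * C j := by
      simp only [hC, Matrix.mulVec, dotProduct, Finset.mul_sum, sqForm]
      rw [← Finset.sum_add_distrib, ← Finset.sum_sub_distrib]
      refine Finset.sum_congr rfl fun k _ => ?_
      split_ifs <;> ring
    rw [this, hs]; ring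
  have hnorm : ‖t‖ = 1 := by
    have : ‖t‖ * ‖t'‖ = 1 := by rw [← norm_mul, htt, norm_one]
    rw [← ht, norm_star] at this
    nlinarith [norm_nonneg t]
  obtain ⟨m, hm, hCm⟩ : ∃ m < n, C m ≠ 0 := by
    by_contra! h
    apply hx
    ext j
    have h1 := hCs j
    rw [h j j.2] at h1
    have h2 : C (j + 1) = 0 := by
      rcases Nat.lt_or_ge (j + 1) n with h' | h'
      · exact h _ h'
      · have := j.2
        rw [show (j : ℕ) + 1 = n by omega, hCn]
    rw [h2] at h1
    simpa using h1.symm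
  have hpos := real_ineq_strict n hn t.re hre (fun k => ‖C k‖) (by simp [hC0]) (by simp [hCn]) m hm
    (by simpa using hCm)
  have hle : 2 * ∑ j ∈ Finset.range n,
      (t.re * (‖C (j + 1)‖ ^ 2 + ‖C j‖ ^ 2) - 2 * ‖C j‖ * ‖C (j + 1)‖) ≤
      (star x ⬝ᵥ (sqForm n t t' *ᵥ x)).re := by
    rw [Finset.mul_sum, ← Fin.sum_univ_eq_sum_range
      (fun j => 2 * (t.re * (‖C (j + 1)‖ ^ 2 + ‖C j‖ ^ 2) - 2 * ‖C j‖ * ‖C (j + 1)‖)) n]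
    simp only [dotProduct, Complex.re_sum]
    refine Finset.sum_le_sum fun j _ => ?_
    have hxj : x j = C (j + 1) - C j := by rw [hCs j]; ring
    rw [hM j, Pi.star_apply, hxj]
    generalize C (j + 1) = c
    generalize C j = d
    have h1 : (t * (star c * d)).re ≤ ‖d‖ * ‖c‖ := by
      refine (Complex.re_le_norm _).trans ?_
      rw [norm_mul, norm_mul, hnorm, norm_star]; apply le_of_eq; ring
    rw [← ht]
    have h2 : (star (c - d) * (2 * (star t * c - t * d))).re =
        2 * (t.re * (‖c‖ ^ 2 + ‖d‖ ^ 2) - 2 * (t * (star c * d)).re) := by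
      rw [← Complex.normSq_eq_norm_sq, ← Complex.normSq_eq_norm_sq, Complex.normSq_apply,
        Complex.normSq_apply]
      simp
      ring
    rw [h2]
    nlinarith
  linarith

lemma group_inv (n : ℕ) (q t t' : ℂ) (htt : t * t' = 1) (hq : q = t * t) (ht : star t = t')
    (β : FreeGroup (Fin (n - 1)) →* GL (Fin n) ℂ)
    (hβ : ∀ i, (β (FreeGroup.of i) : Matrix (Fin n) (Fin n) ℂ) = burauMatrix n q i)
    (w : FreeGroup (Fin (n - 1))) :
    (β w : Matrix (Fin n) (Fin n) ℂ)ᴴ * sqForm n t t' * (β w : Matrix (Fin n) (Fin n) ℂ)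
      = sqForm n t t' ∧ (1 : Fin n → ℂ) ᵥ* (β w : Matrix (Fin n) (Fin n) ℂ) = 1 := by
  induction w using FreeGroup.induction_on with
  | C1 => simp
  | of i => rw [hβ i]; exact ⟨burau_inv n t t' q htt hq ht i, burau_one n q i⟩
  | inv_of i ih =>
    obtain ⟨h1, h2⟩ := ih
    have hm : (β (FreeGroup.of i) : Matrix (Fin n) (Fin n) ℂ) *
      ((β (FreeGroup.of i)⁻¹ : GL (Fin n) ℂ) : Matrix (Fin n) (Fin n) ℂ) = 1 := by
      rw [map_inv, ← Units.val_mul, mul_inv_cancel, Units.val_one]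
    generalize (β (FreeGroup.of i) : Matrix (Fin n) (Fin n) ℂ) = A at *
    generalize ((β (FreeGroup.of i)⁻¹ : GL (Fin n) ℂ) : Matrix (Fin n) (Fin n) ℂ) = B at *
    constructor
    · have h3 : Bᴴ * Aᴴ = 1 := by rw [← conjTranspose_mul, hm, conjTranspose_one]
      calc Bᴴ * sqForm n t t' * B = Bᴴ * (Aᴴ * sqForm n t t' * A) * B := by rw [h1]
        _ = (Bᴴ * Aᴴ) * sqForm n t t' * (A * B) := by simp only [Matrix.mul_assoc]
        _ = _ := by rw [h3, hm, one_mul, mul_one]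
    · conv_lhs => rw [← h2]
      rw [vecMul_vecMul, hm, vecMul_one]
  | mul x y hx hy =>
    obtain ⟨h1, h2⟩ := hx
    obtain ⟨h3, h4⟩ := hy
    rw [map_mul, Units.val_mul]
    generalize (β x : Matrix (Fin n) (Fin n) ℂ) = A at *
    generalize (β y : Matrix (Fin n) (Fin n) ℂ) = B at *
    constructor
    · rw [conjTranspose_mul]
      calc Bᴴ * Aᴴ * sqForm n t t' * (A * B) = Bᴴ * (Aᴴ * sqForm n t t' * A) * B := by
            simp only [Matrix.mul_assoc]
        _ = _ := by rw [h1, h3]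
    · rw [← vecMul_vecMul, h2, h4]

/-- **Riemann hypothesis analogue for the braid zeta function.** If `q = e^{iθ}` with
`|θ| < 2π/n`, then every eigenvalue of `β_{n,q}(w)` has absolute value `1`, and every
`s ∈ ℂ` with `det(I_n − e^{−s}·β_{n,q}(w)) = 0` satisfies `Re(s) = 0`. -/
theorem braid_zeta_riemann_hypothesis (n : ℕ) (hn : 2 ≤ n) (θ : ℝ)
    (hθ : |θ| < 2 * Real.pi / n) (q : ℂ) (hq : q = Complex.exp (θ * Complex.I))
    (β : FreeGroup (Fin (n - 1)) →* GL (Fin n) ℂ)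
    (hβ : ∀ i, (β (FreeGroup.of i) : Matrix (Fin n) (Fin n) ℂ) = burauMatrix n q i)
    (w : FreeGroup (Fin (n - 1))) :
    (∀ α : ℂ,
        (α • (1 : Matrix (Fin n) (Fin n) ℂ) - (β w : Matrix (Fin n) (Fin n) ℂ)).det = 0 →
        ‖α‖ = 1) ∧
    (∀ s : ℂ,
        ((1 : Matrix (Fin n) (Fin n) ℂ)
          - Complex.exp (-s) • (β w : Matrix (Fin n) (Fin n) ℂ)).det = 0 →
        s.re = 0) := by
  have hn0 : (0 : ℝ) < n := by exact_mod_cast (by omega : 0 < n)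
  have first : ∀ α : ℂ,
        (α • (1 : Matrix (Fin n) (Fin n) ℂ) - (β w : Matrix (Fin n) (Fin n) ℂ)).det = 0 →
        ‖α‖ = 1 := by
    intro α hα
    set t : ℂ := Complex.exp ((θ / 2 : ℝ) * Complex.I) with htdef
    have hnt : ‖t‖ = 1 := Complex.norm_exp_ofReal_mul_I _
    have htt : t * star t = 1 := by
      have := Complex.mul_conj t
      rw [Complex.normSq_eq_norm_sq, hnt] at this
      simpa using this
    have hqt : q = t * t := by
      rw [hq, htdef, ← Complex.exp_add]; congr 1; push_cast; ring
    have hre : Real.cos (Real.pi / n) < t.re := by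
      rw [htdef, Complex.exp_ofReal_mul_I_re, ← Real.cos_abs (θ / 2)]
      apply Real.cos_lt_cos_of_nonneg_of_le_pi (abs_nonneg _)
      · apply div_le_self Real.pi_pos.le
        exact_mod_cast (by omega : 1 ≤ n)
      · rw [abs_div, abs_two, div_lt_iff₀ two_pos]
        calc |θ| < 2 * Real.pi / n := hθ
          _ = _ := by ring
    obtain ⟨hF, hone⟩ := group_inv n q t (star t) htt hqt rfl β hβ w
    obtain ⟨x, hx0, hx⟩ := Matrix.exists_mulVec_eq_zero_iff.2 hα
    generalize (β w : Matrix (Fin n) (Fin n) ℂ) = A at *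
    have hAx : A *ᵥ x = α • x := by
      rw [sub_mulVec, smul_mulVec, one_mulVec, sub_eq_zero] at hx
      exact hx.symm
    have hsum : (α - 1) * ∑ k, x k = 0 := by
      have h1 : (1 : Fin n → ℂ) ⬝ᵥ (A *ᵥ x) = 1 ⬝ᵥ x := by rw [dotProduct_mulVec, hone]
      rw [hAx, dotProduct_smul, one_dotProduct, smul_eq_mul] at h1
      linear_combination h1
    rcases mul_eq_zero.1 hsum with h | h
    · rw [sub_eq_zero.1 h, norm_one]
    · have hpos := form_pos n hn t (star t) htt rfl hre x hx0 h
      have h2 : star (A *ᵥ x) ⬝ᵥ (sqForm n t (star t) *ᵥ (A *ᵥ x)) =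
          star x ⬝ᵥ (sqForm n t (star t) *ᵥ x) := by
        conv_rhs => rw [← hF]
        rw [star_mulVec, ← dotProduct_mulVec, mulVec_mulVec, mulVec_mulVec, Matrix.mul_assoc]
      rw [hAx, mulVec_smul, star_smul, smul_dotProduct, dotProduct_smul, smul_eq_mul, smul_eq_mul,
        ← mul_assoc] at h2
      have hne : star x ⬝ᵥ (sqForm n t (star t) *ᵥ x) ≠ 0 := by
        intro h0; rw [h0] at hpos; simp at hpos
      have h3 : star α * α = 1 := mul_right_cancel₀ hne (by rw [h2, one_mul])
      have h4 : ‖α‖ * ‖α‖ = 1 := by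
        have := congrArg norm h3
        rwa [norm_mul, norm_star, norm_one] at this
      nlinarith [norm_nonneg α]
  refine ⟨first, fun s hs => ?_⟩
  have h1 : ‖Complex.exp s‖ = 1 := by
    apply first
    have : Complex.exp s • (1 : Matrix (Fin n) (Fin n) ℂ) - (β w : Matrix (Fin n) (Fin n) ℂ)
        = Complex.exp s • ((1 : Matrix (Fin n) (Fin n) ℂ)
          - Complex.exp (-s) • (β w : Matrix (Fin n) (Fin n) ℂ)) := by
      rw [smul_sub, smul_smul, ← Complex.exp_add, add_neg_cancel, Complex.exp_zero, one_smul]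
    rw [this, det_smul, hs, mul_zero]
  rw [Complex.norm_exp] at h1
  exact (Real.exp_eq_one_iff _).1 h1
end

section
/- Let n ≥ 2 and m ∈ ℤ with gcd(n, |m|) = 1. Then for every q ∈ ℂ with q ≠ 0, (1 − q^m) · det(I_{n−1} − (B^r_1 B^r_2 ⋯ B^r_{n−1})^m) = 1 − q^{nm}. (Since det(I_{n−1} − β^r_{n,q}(σ)) = [n]_q · Δ_{σ̂}(q) with [n]_q = (1−q^n)/(1−q), this is the classical formula Δ_{T(n,m)}(q) = (1−q)(1−q^{nm}) / ((1−q^n)(1−q^m)) for the Alexander polynomial of the torus knot T(n,m).) -/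
open Matrix

/-- The reduced Burau image `B^r_1 B^r_2 ⋯ B^r_{n−1}` of the braid `σ_1 σ_2 ⋯ σ_{n−1}`. -/
noncomputable def rBurauProd (n : ℕ) (q : ℂ) : Matrix (Fin (n - 1)) (Fin (n - 1)) ℂ :=
  ((List.finRange (n - 1)).map (rBurauMatrix n q)).prod

theorem rb_vecMul (n : ℕ) (q : ℂ) (i : Fin (n - 1)) (w : Fin (n - 1) → ℂ) (k : Fin (n - 1)) :
    (w ᵥ* rBurauMatrix n q i) k = (if (k : ℕ) = i then 0 else w k) +
      w i * (if (k : ℕ) + 1 = i then q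
    else if (k : ℕ) = i then -q
    else if (k : ℕ) = (i : ℕ) + 1 then 1
    else 0) := by
  set r : ℂ := (if (k : ℕ) + 1 = i then q
    else if (k : ℕ) = i then -q
    else if (k : ℕ) = (i : ℕ) + 1 then 1
    else 0) with hr
  have h : ∀ j, w j * rBurauMatrix n q i j k
      = (if j = k then (if (k : ℕ) = i then 0 else w k) else 0) + (if j = i then w i * r else 0) := by
    intro j
    unfold rBurauMatrix
    rw [← hr]
    by_cases hji : j = i
    · subst hji
      by_cases hjk : j = k
      · subst hjk; simp
      · simp [hjk]
    · have h1 : (j : ℕ) ≠ i := fun h => hji (Fin.ext h)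
      by_cases hjk : j = k
      · subst hjk; simp [h1, hji]
      · simp [hjk, h1, hji]
  simp only [Matrix.vecMul, dotProduct, h, Finset.sum_add_distrib, Finset.sum_ite_eq',
    Finset.mem_univ, if_true]

noncomputable def rbState (q l : ℂ) (i k : ℕ) : ℂ :=
  if k + 1 < i then q * l ^ (k + 1)
  else if k + 1 = i then -q * ∑ j ∈ Finset.range i, l ^ j
  else if k = i then ∑ j ∈ Finset.range (i + 1), l ^ j
  else l ^ k

theorem rbState_step (n : ℕ) (q l : ℂ) (i : Fin (n - 1)) :
    (fun k : Fin (n - 1) => rbState q l i k) ᵥ* rBurauMatrix n q i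
      = fun k : Fin (n - 1) => rbState q l (i + 1) k := by
  ext k
  rw [rb_vecMul]
  obtain ⟨i, hi⟩ := i
  obtain ⟨k, hk⟩ := k
  simp only [rbState]
  rcases lt_trichotomy (k + 1) i with h | h | h
  · have : k ≠ i := by omega
    have : k ≠ i + 1 := by omega
    have : k + 1 ≠ i := by omega
    have : k < i := by omega
    simp [*]
  · subst h
    simp [Finset.sum_range_succ]
    ring
  · rcases Nat.lt_or_ge i k with h2 | h2
    · rcases Nat.eq_or_lt_of_le h2 with h3 | h3
      · subst h3
        have e1 : ¬ (i + 1 + 1 < i) := by omega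
        have e2 : ¬ (i + 1 + 1 = i) := by omega
        simp [Finset.sum_range_succ, e1, e2]
        ring
      · have : k ≠ i := by omega
        have : k ≠ i + 1 := by omega
        have : k + 1 ≠ i := by omega
        have : ¬ k < i := by omega
        have : ¬ k + 1 < i := by omega
        simp [*]
    · have : k = i := by omega
      subst this
      simp
      ring

theorem rbState_take (n : ℕ) (q l : ℂ) (i : ℕ) (hi : i ≤ n - 1) :
    (fun k : Fin (n - 1) => l ^ (k : ℕ)) ᵥ*
      (((List.finRange (n - 1)).map (rBurauMatrix n q)).take i).prod
      = fun k : Fin (n - 1) => rbState q l i k := by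
  induction i with
  | zero =>
    ext k
    simp only [List.take_zero, List.prod_nil, Matrix.vecMul_one, rbState]
    rcases Nat.eq_zero_or_pos (k : ℕ) with h | h
    · simp [h]
    · simp [h.ne']
  | succ i ih =>
    rw [List.prod_take_succ _ _ (by simpa using hi), ← Matrix.vecMul_vecMul, ih (by omega)]
    have := rbState_step n q l ⟨i, hi⟩
    simpa using this

theorem rb_eigen (n : ℕ) (hn : 2 ≤ n) (q l : ℂ) (hl : l ^ n = 1) (hl1 : l ≠ 1) :
    (fun k : Fin (n - 1) => l ^ (k : ℕ)) ᵥ* rBurauProd n q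
      = fun k : Fin (n - 1) => q * l * l ^ (k : ℕ) := by
  have h := rbState_take n q l (n - 1) le_rfl
  rw [List.take_of_length_le (by simp)] at h
  rw [rBurauProd, h]
  ext k
  obtain ⟨k, hk⟩ := k
  simp only [rbState]
  by_cases h1 : k + 1 < n - 1
  · simp [h1]; ring
  · have h2 : k + 1 = n - 1 := by omega
    have hs : ∑ j ∈ Finset.range n, l ^ j = 0 := by
      have := mul_geom_sum l n
      rw [hl, sub_self] at this
      exact (mul_eq_zero.mp this).resolve_left (sub_ne_zero.mpr hl1)
    obtain ⟨n, rfl⟩ : ∃ a, n = a + 1 := ⟨n - 1, by omega⟩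
    rw [Finset.sum_range_succ] at hs
    simp only [Nat.add_sub_cancel] at h2 ⊢
    rw [if_neg (by omega), if_pos h2, eq_neg_of_add_eq_zero_left hs, ← h2]
    ring

theorem rb_diag_zpow {N : ℕ} (d : Fin N → ℂ) (hd : ∀ i, d i ≠ 0) (m : ℤ) :
    (Matrix.diagonal d) ^ m = Matrix.diagonal (fun i => d i ^ m) := by
  cases m with
  | ofNat a =>
    simp only [Int.ofNat_eq_natCast, zpow_natCast, Matrix.diagonal_pow]
    rfl
  | negSucc a =>
    rw [_root_.zpow_negSucc, Matrix.diagonal_pow]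
    apply Matrix.inv_eq_right_inv
    rw [Matrix.diagonal_mul_diagonal, ← Matrix.diagonal_one]
    congr 1
    ext i
    simp [_root_.zpow_negSucc, hd i]

theorem torus_knot_alexander (n : ℕ) (hn : 2 ≤ n) (m : ℤ) (hnm : Nat.Coprime n m.natAbs)
    (q : ℂ) (hq : q ≠ 0) :
    (1 - q ^ m) *
        ((1 : Matrix (Fin (n - 1)) (Fin (n - 1)) ℂ) - rBurauProd n q ^ m).det
      = 1 - q ^ ((n : ℤ) * m) := by
  obtain ⟨z, hz⟩ : ∃ z : ℂ, IsPrimitiveRoot z n :=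
    ⟨_, Complex.isPrimitiveRoot_exp n (by omega)⟩
  have hz0 : z ≠ 0 := hz.ne_zero (by omega)
  set V : Matrix (Fin (n - 1)) (Fin (n - 1)) ℂ :=
    Matrix.vandermonde (fun i => z ^ ((i : ℕ) + 1)) with hV
  set d : Fin (n - 1) → ℂ := fun i => q * z ^ ((i : ℕ) + 1) with hd
  have hd0 : ∀ i, d i ≠ 0 := fun i => mul_ne_zero hq (pow_ne_zero _ hz0)
  have hVdet : V.det ≠ 0 := by
    rw [hV, Matrix.det_vandermonde_ne_zero_iff]
    intro i j hij
    have := hz.pow_inj (by omega) (by omega) hij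
    exact Fin.ext (by omega)
  have hVC : V * rBurauProd n q = Matrix.diagonal d * V := by
    ext i k
    have := congrFun (rb_eigen n hn q (z ^ ((i : ℕ) + 1))
      (by rw [← pow_mul, mul_comm, pow_mul, hz.pow_eq_one, one_pow])
      (hz.pow_ne_one_of_pos_of_lt (by omega) (by omega))) k
    rw [Matrix.diagonal_mul]
    exact this
  have hD : IsUnit (Matrix.diagonal d).det := by
    rw [Matrix.det_diagonal, isUnit_iff_ne_zero]
    exact Finset.prod_ne_zero_iff.mpr fun i _ => hd0 i
  have hC : IsUnit (rBurauProd n q).det := by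
    have h := congrArg Matrix.det hVC
    rw [Matrix.det_mul, Matrix.det_mul] at h
    rw [isUnit_iff_ne_zero] at hD ⊢
    intro h0
    rw [h0, mul_zero] at h
    exact mul_ne_zero hD hVdet h.symm
  have hm : V * rBurauProd n q ^ m = Matrix.diagonal d ^ m * V :=
    Matrix.SemiconjBy.zpow_right hC hD hVC m
  have hdet : ((1 : Matrix (Fin (n - 1)) (Fin (n - 1)) ℂ) - rBurauProd n q ^ m).det
      = ∏ i, (1 - d i ^ m) := by
    have h : V * (1 - rBurauProd n q ^ m) = Matrix.diagonal (fun i => 1 - d i ^ m) * V := by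
      rw [mul_sub, hm, rb_diag_zpow d hd0, mul_one]
      ext i k
      simp [Matrix.diagonal_mul, sub_mul]
    have h2 := congrArg Matrix.det h
    rw [Matrix.det_mul, Matrix.det_mul, mul_comm, Matrix.det_diagonal] at h2
    exact mul_right_cancel₀ hVdet h2
  have hzm : IsPrimitiveRoot (z ^ m) n := by
    apply hz.zpow_of_gcd_eq_one
    rw [Int.gcd_comm]
    simpa [Int.gcd] using hnm
  have key := congrArg (Polynomial.eval 1)
    (X_pow_sub_C_eq_prod hzm (by omega : 0 < n) (rfl : (q ^ m) ^ n = (q ^ m) ^ n))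
  simp only [Polynomial.eval_sub, Polynomial.eval_pow, Polynomial.eval_X, Polynomial.eval_C,
    Polynomial.eval_prod, one_pow] at key
  rw [hdet, mul_comm (n : ℤ) m, _root_.zpow_mul, _root_.zpow_natCast, key]
  obtain ⟨N, rfl⟩ : ∃ a, n = a + 1 := ⟨n - 1, by omega⟩
  rw [Finset.prod_range_succ', mul_comm, pow_zero, one_mul]
  congr 1
  rw [Finset.prod_range]
  apply Finset.prod_congr rfl
  intro i _
  simp only [hd, mul_zpow]
  rw [← _root_.zpow_natCast, ← _root_.zpow_natCast, ← _root_.zpow_mul, ← _root_.zpow_mul, mul_comm (q ^ m), mul_comm m]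
end

section
/- Let n ≥ 2 and m, m' ∈ ℤ with gcd(n, |m|) = 1 and gcd(n, |m + m'|) = 1. Then for every q ∈ ℂ with q ≠ 0 and every s ∈ ℂ, (1 − s) · det(I_n − q^{m'} s · T_{n,m}) = (1 − q^{m'} s) · det(I_n − s · T_{n,m+m'}). Equivalently, (1 − s)·ζ(s, σ_{n,m+m'}; β_{n,q}) = (1 − q^{m'}s)·ζ(q^{m'}s, σ_{n,m}; β_{n,q}). -/
open Matrix

/-- The Burau image `B_1 B_2 ⋯ B_{n−1}` of the braid `σ_1 σ_2 ⋯ σ_{n−1}`. -/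
noncomputable def burauProd (n : ℕ) (q : ℂ) : Matrix (Fin n) (Fin n) ℂ :=
  ((List.finRange (n - 1)).map (burauMatrix n q)).prod

/-- The torus type braid matrix `T_{n,m} = (B_1 ⋯ B_{n−1})^m`. -/
noncomputable def torusBurau (n : ℕ) (q : ℂ) (m : ℤ) : Matrix (Fin n) (Fin n) ℂ :=
  burauProd n q ^ m

/-- scaled permutation matrix plus a matrix with constant rows -/
noncomputable def permRank {n : ℕ} (a : ℂ) (τ : Equiv.Perm (Fin n)) (v : Fin n → ℂ) :
    Matrix (Fin n) (Fin n) ℂ := fun i j => (if i = τ j then a else 0) + v i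

lemma permRank_mul {n : ℕ} (a b : ℂ) (τ σ : Equiv.Perm (Fin n)) (v w : Fin n → ℂ) :
    permRank a τ v * permRank b σ w =
      permRank (a * b) (τ * σ) (fun i => a * w (τ⁻¹ i) + b * v i + v i * ∑ k, w k) := by
  ext i j
  have h : ∀ x, (i = τ x) ↔ (τ⁻¹ i = x) := fun x => by
    rw [Equiv.Perm.inv_eq_iff_eq]
  simp only [permRank, Matrix.mul_apply, add_mul, mul_add, Finset.sum_add_distrib, h,
    Equiv.Perm.mul_apply, ← Finset.mul_sum]
  simp
  ring

lemma permRank_one {n : ℕ} : (1 : Matrix (Fin n) (Fin n) ℂ) = permRank 1 1 0 := by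
  ext i j
  rw [Matrix.one_apply]
  by_cases h : i = j
  · have h' : i = (1 : Equiv.Perm (Fin n)) j := h
    rw [permRank, if_pos h, if_pos h', Pi.zero_apply, add_zero]
  · have h' : ¬ i = (1 : Equiv.Perm (Fin n)) j := h
    rw [permRank, if_neg h, if_neg h', Pi.zero_apply, add_zero]

/-- partial products -/
noncomputable def partQ (n : ℕ) (q : ℂ) (k : ℕ) : Matrix (Fin n) (Fin n) ℂ := fun i j =>
  if (j : ℕ) < k then
    (if (i : ℕ) = 0 then 1 - q else 0) + (if (i : ℕ) = j + 1 then q else 0)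
  else if (j : ℕ) = k then (if (i : ℕ) = 0 then 1 else 0)
  else if i = j then 1 else 0

lemma partQ_mul (n : ℕ) (q : ℂ) (k : Fin (n - 1)) :
    partQ n q k * burauMatrix n q k = partQ n q (k + 1) := by
  have hk := k.2
  obtain ⟨a, ha⟩ : ∃ a : Fin n, (a : ℕ) = k := ⟨⟨k, by omega⟩, rfl⟩
  obtain ⟨b, hb⟩ : ∃ b : Fin n, (b : ℕ) = k + 1 := ⟨⟨k + 1, by omega⟩, rfl⟩
  have hB : ∀ l j, burauMatrix n q k l j =
      if j = a then (if l = a then 1 - q else 0) + (if l = b then q else 0)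
      else if j = b then (if l = a then 1 else 0)
      else if l = j then 1 else 0 := by
    intro l j
    simp only [burauMatrix, Fin.ext_iff, ha, hb]
    split_ifs <;> first | omega | simp
  ext i j
  rw [Matrix.mul_apply]
  simp only [hB]
  by_cases h1 : j = a
  · subst h1
    simp only [if_true, mul_add, Finset.sum_add_distrib, mul_ite, mul_zero,
      Finset.sum_ite_eq', Finset.sum_ite_eq, Finset.mem_univ]
    simp only [partQ, Fin.ext_iff, ha, hb]
    split_ifs <;> first | omega | simp
  · by_cases h2 : j = b
    · subst h2
      simp only [h1, if_true, if_false, mul_ite, mul_zero, mul_one,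
        Finset.sum_ite_eq', Finset.sum_ite_eq, Finset.mem_univ]
      simp [partQ, ha, hb]
    · simp only [h1, h2, if_true, if_false, mul_ite, mul_zero, mul_one,
        Finset.sum_ite_eq', Finset.sum_ite_eq, Finset.mem_univ]
      simp only [Fin.ext_iff, ha, hb] at h1 h2
      simp only [partQ]
      split_ifs <;> first | omega | rfl

lemma burauProd_take (n : ℕ) (q : ℂ) (k : ℕ) (hk : k ≤ n - 1) :
    (((List.finRange (n - 1)).take k).map (burauMatrix n q)).prod = partQ n q k := by
  induction k with
  | zero =>
    ext i j
    simp only [List.take_zero, List.map_nil, List.prod_nil, Matrix.one_apply, partQ, Fin.ext_iff]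
    split_ifs <;> first | omega | rfl
  | succ k ih =>
    have hl : k < (List.finRange (n - 1)).length := by simpa using hk
    rw [List.take_succ_eq_append_getElem hl, List.map_append, List.prod_append, ih (by omega)]
    simpa using partQ_mul n q ⟨k, by omega⟩

lemma burauProd_eq (n : ℕ) (q : ℂ) :
    burauProd (n + 1) q =
      permRank q (finRotate (n + 1)) (fun i => if i = 0 then 1 - q else 0) := by
  have h := burauProd_take (n + 1) q n (by simp)
  rw [List.take_of_length_le (by simp)] at h
  rw [burauProd, h]
  ext i j
  have hi := i.2
  have hj := j.2
  simp only [partQ, permRank]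
  rcases Nat.lt_or_ge (j : ℕ) n with hjn | hjn
  · have : ((finRotate (n + 1) j : Fin (n + 1)) : ℕ) = j + 1 := by
      rw [coe_finRotate_of_ne_last]
      rintro rfl
      simp at hjn
    simp only [Fin.ext_iff, this, hjn, if_true, Fin.val_zero]
    ring
  · have hjl : j = Fin.last n := Fin.ext (by simp; omega)
    subst hjl
    simp only [finRotate_last, Fin.ext_iff, Fin.val_zero, Fin.val_last, lt_irrefl, if_true, if_false]
    split_ifs <;> simp

lemma burauProd_inv (n : ℕ) (q : ℂ) (hq : q ≠ 0) :
    burauProd (n + 1) q *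
      permRank q⁻¹ (finRotate (n + 1))⁻¹ (fun i => if i = Fin.last n then (q - 1) / q else 0)
      = 1 := by
  rw [burauProd_eq, permRank_mul, permRank_one, mul_inv_cancel₀ hq, mul_inv_cancel]
  congr 1
  ext i
  have : (finRotate (n + 1))⁻¹ i = Fin.last n ↔ i = 0 := by
    rw [Equiv.Perm.inv_eq_iff_eq, finRotate_last]
  simp only [this]
  simp
  split_ifs
  · field_simp
    ring
  · simp

lemma torus_form (n : ℕ) (q : ℂ) (hq : q ≠ 0) (m : ℤ) :
    ∃ v : Fin (n + 1) → ℂ, ∑ i, v i = 1 - q ^ m ∧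
      torusBurau (n + 1) q m = permRank (q ^ m) (finRotate (n + 1) ^ m) v := by
  have hinv := burauProd_inv n q hq
  have hu : IsUnit (burauProd (n + 1) q).det := by
    rw [← Matrix.isUnit_iff_isUnit_det]
    exact IsUnit.of_mul_eq_one _ hinv
  have step : ∀ (a b : ℂ) (τ : Equiv.Perm (Fin (n + 1))) (v w : Fin (n + 1) → ℂ),
      ∑ i, v i = 1 - a → ∑ i, w i = 1 - b →
      ∑ i, (a * w (τ⁻¹ i) + b * v i + v i * ∑ k, w k) = 1 - a * b := by
    intro a b τ v w hv hw
    rw [Finset.sum_add_distrib, Finset.sum_add_distrib, ← Finset.mul_sum, ← Finset.mul_sum,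
      ← Finset.sum_mul, Equiv.sum_comp τ⁻¹ w, hv, hw]
    ring
  have sum0 : ∑ i : Fin (n + 1), (if i = 0 then 1 - q else 0) = 1 - q := by
    rw [Finset.sum_ite_eq' Finset.univ 0 (fun _ => 1 - q), if_pos (Finset.mem_univ _)]
  have sum1 : ∑ i : Fin (n + 1), (if i = Fin.last n then (q - 1) / q else 0) = 1 - q⁻¹ := by
    rw [Finset.sum_ite_eq' Finset.univ (Fin.last n) (fun _ => (q - 1) / q),
      if_pos (Finset.mem_univ _)]
    field_simp
  unfold torusBurau
  induction m using Int.induction_on with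
  | zero => exact ⟨0, by simp, by simpa using permRank_one⟩
  | succ i ih =>
    obtain ⟨v, hv, h⟩ := ih
    rw [Matrix.zpow_add_one hu, h, burauProd_eq, permRank_mul, zpow_add_one₀ hq, _root_.zpow_add_one]
    exact ⟨_, step _ _ _ _ _ hv sum0, rfl⟩
  | pred i ih =>
    obtain ⟨v, hv, h⟩ := ih
    rw [Matrix.zpow_sub_one hu, h, Matrix.inv_eq_right_inv hinv, permRank_mul,
      zpow_sub_one₀ hq, _root_.zpow_sub_one]
    exact ⟨_, step _ _ _ _ _ hv sum1, rfl⟩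

lemma det_form {n : ℕ} (a x : ℂ) (τ : Equiv.Perm (Fin n)) (v : Fin n → ℂ)
    (hv : ∑ i, v i = 1 - a) (hy : 1 - x * a ≠ 0) :
    (1 - x * a) * (1 - x • permRank a τ v).det = (1 - x) * (1 - permRank (x * a) τ 0).det := by
  have h : (1 - x • permRank a τ v) =
      (1 + replicateCol Unit (fun i => -(x / (1 - x * a)) * v i) *
        replicateRow Unit (fun _ => (1 : ℂ))) * (1 - permRank (x * a) τ 0) := by
    have hc : replicateRow Unit (fun _ : Fin n => (1 : ℂ)) * (1 - permRank (x * a) τ 0) =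
        (1 - x * a) • replicateRow Unit (fun _ => (1 : ℂ)) := by
      ext i j
      simp [Matrix.mul_apply, permRank, Matrix.one_apply, Finset.sum_sub_distrib]
    rw [add_mul, one_mul, Matrix.mul_assoc, hc]
    ext i j
    simp [Matrix.mul_apply, permRank]
    field_simp
    split_ifs <;> ring
  rw [h, det_mul, det_one_add_replicateCol_mul_replicateRow]
  have : (fun _ => (1 : ℂ)) ⬝ᵥ (fun i => -(x / (1 - x * a)) * v i) =
      -(x / (1 - x * a)) * (1 - a) := by
    simp only [dotProduct, one_mul, ← Finset.mul_sum, hv]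
  rw [this]
  field_simp
  ring

lemma cycleType_zpow (n : ℕ) (hn : 2 ≤ n) (m : ℤ) (h : Nat.Coprime n m.natAbs) :
    (finRotate n ^ m).cycleType = {n} := by
  have hc := isCycle_finRotate_of_le hn
  have ho : orderOf (finRotate n) = n := by
    rw [hc.orderOf, support_finRotate_of_le hn]; simp
  have key : (finRotate n ^ m.natAbs).cycleType = {n} := by
    have h' : Nat.Coprime m.natAbs (orderOf (finRotate n)) := by rw [ho]; exact h.symm
    rw [(hc.pow_iff.2 h').cycleType, Equiv.Perm.support_pow_coprime h',
      support_finRotate_of_le hn]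
    simp
  rcases Int.natAbs_eq m with hm | hm
  · rw [hm, zpow_natCast]; exact key
  · rw [hm, _root_.zpow_neg, zpow_natCast, Equiv.Perm.cycleType_inv]; exact key

lemma det_conj {n : ℕ} (z : ℂ) (τ σ : Equiv.Perm (Fin n)) (h : IsConj τ σ) :
    (1 - permRank z τ 0).det = (1 - permRank z σ 0).det := by
  obtain ⟨c, hc⟩ := isConj_iff.1 h
  rw [← Matrix.det_submatrix_equiv_self c (1 - permRank z σ 0)]
  congr 1
  ext i j
  subst hc
  simp [permRank, Matrix.one_apply]

/-- **Shift relation for torus braid zeta functions.** For `gcd(n,|m|) = 1` and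
`gcd(n,|m+m'|) = 1`,
`(1 − s)·det(I_n − q^{m'}s·T_{n,m}) = (1 − q^{m'}s)·det(I_n − s·T_{n,m+m'})`, i.e.
`(1 − s)·ζ(s, σ_{n,m+m'}; β_{n,q}) = (1 − q^{m'}s)·ζ(q^{m'}s, σ_{n,m}; β_{n,q})`. -/
theorem torus_braid_zeta_shift (n : ℕ) (hn : 2 ≤ n) (m m' : ℤ)
    (hnm : Nat.Coprime n m.natAbs) (hnm' : Nat.Coprime n (m + m').natAbs)
    (q : ℂ) (hq : q ≠ 0) (s : ℂ) :
    (1 - s) * ((1 : Matrix (Fin n) (Fin n) ℂ) - (q ^ m' * s) • torusBurau n q m).det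
      = (1 - q ^ m' * s) *
        ((1 : Matrix (Fin n) (Fin n) ℂ) - s • torusBurau n q (m + m')).det := by
  obtain ⟨k, rfl⟩ : ∃ k, n = k + 1 := ⟨n - 1, by omega⟩
  obtain ⟨v, hv, h1⟩ := torus_form k q hq m
  obtain ⟨w, hw, h2⟩ := torus_form k q hq (m + m')
  have hconj : IsConj (finRotate (k + 1) ^ m) (finRotate (k + 1) ^ (m + m')) := by
    rw [Equiv.Perm.isConj_iff_cycleType_eq, cycleType_zpow _ hn _ hnm, cycleType_zpow _ hn _ hnm']
  have hadd : q ^ (m + m') = q ^ m * q ^ m' := zpow_add₀ hq m m'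
  have hQ : q ^ (m + m') ≠ 0 := zpow_ne_zero _ hq
  have hd : Dense {s : ℂ | s ≠ (q ^ (m + m'))⁻¹} := dense_compl_singleton _
  refine congrFun (Continuous.ext_on hd (f := fun s : ℂ => (1 - s) *
      ((1 : Matrix (Fin (k + 1)) (Fin (k + 1)) ℂ) - (q ^ m' * s) • torusBurau (k + 1) q m).det)
    (g := fun s : ℂ => (1 - q ^ m' * s) *
      ((1 : Matrix (Fin (k + 1)) (Fin (k + 1)) ℂ) - s • torusBurau (k + 1) q (m + m')).det)
    ?_ ?_ ?_) s
  · exact (by fun_prop : Continuous fun s : ℂ => 1 - s).mul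
      (Continuous.matrix_det (by fun_prop))
  · exact (by fun_prop : Continuous fun s : ℂ => 1 - q ^ m' * s).mul
      (Continuous.matrix_det (by fun_prop))
  · intro s hs
    have hy : 1 - s * q ^ (m + m') ≠ 0 := by
      intro h
      exact hs (eq_inv_of_mul_eq_one_left (sub_eq_zero.1 h).symm)
    have e : q ^ m' * s * q ^ m = s * q ^ (m + m') := by rw [hadd]; ring
    have d1 := det_form (q ^ m) (q ^ m' * s) (finRotate (k + 1) ^ m) v hv (by rw [e]; exact hy)
    have d2 := det_form (q ^ (m + m')) s (finRotate (k + 1) ^ (m + m')) w hw hy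
    rw [e, ← h1, det_conj _ _ _ hconj] at d1
    rw [← h2] at d2
    apply mul_left_cancel₀ hy
    show _ * ((1 - s) * _) = _ * ((1 - q ^ m' * s) * _)
    linear_combination (1 - s) * d1 - (1 - q ^ m' * s) * d2
end

section
/- Let r ≥ 1, n ≥ 2 and m ∈ ℤ be such that gcd(n, r!·|m|) = 1. For 0 ≤ l ≤ r set b_{r,l,n} := C(r,l)·((n−1)^l − (−1)^l)/n, which is a nonnegative integer. Then for every q ∈ ℂ with q ≠ 0 and every s ∈ ℂ, det(I_{n^r} − s · T_{n,m}^{⊗r}) · ∏_{1 ≤ l ≤ r, l odd} (1 − q^{lm}s)^{C(r,l)} = ∏_{0 ≤ l ≤ r, l even} (1 − q^{lm}s)^{C(r,l)} · ∏_{l=1}^{r} (1 − q^{lmn}s^n)^{b_{r,l,n}}, where T_{n,m}^{⊗r} denotes the r-fold Kronecker product T_{n,m} ⊗ ⋯ ⊗ T_{n,m}. Equivalently, with a_{r,l} := (−1)^l C(r,l), the zeta function of the tensor-power Burau representation satisfies ζ(s, σ_{n,m}; β_{n,q}^{⊗r}) = ∏_{l=0}^{r} (1 − q^{lm}s)^{−a_{r,l}}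 (1 − q^{lmn}s^n)^{−b_{r,l,n}}. -/
open Matrix

/-- The `r`-fold Kronecker tensor power `M^{⊗r}` of a matrix, realized as a matrix
indexed by `Fin r → Fin n` with entries `∏ i, M (v i) (w i)`. -/
noncomputable def kroneckerPow {n : ℕ} (M : Matrix (Fin n) (Fin n) ℂ) (r : ℕ) :
    Matrix (Fin r → Fin n) (Fin r → Fin n) ℂ :=
  fun v w => ∏ i, M (v i) (w i)

noncomputable def burauNat (n : ℕ) (q : ℂ) (i : ℕ) :
    Matrix (Fin n) (Fin n) ℂ := fun j k =>
  if (j : ℕ) = i ∧ (k : ℕ) = i then 1 - q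
  else if (j : ℕ) = i ∧ (k : ℕ) = (i : ℕ) + 1 then 1
  else if (j : ℕ) = (i : ℕ) + 1 ∧ (k : ℕ) = i then q
  else if (j : ℕ) = (i : ℕ) + 1 ∧ (k : ℕ) = (i : ℕ) + 1 then 0
  else if j = k then 1 else 0

theorem burauProd_eq_s18 (n : ℕ) (q : ℂ) :
    burauProd n q = ((List.range (n - 1)).map (burauNat n q)).prod := by
  rw [burauProd, ← List.map_coe_finRange_eq_range, List.map_map]
  rfl

theorem burauNat_colsum (n : ℕ) (q : ℂ) (i : ℕ) (hi : i < n - 1) :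
    (fun _ => 1) ᵥ* burauNat n q i = fun _ => 1 := by
  ext k
  simp only [vecMul, dotProduct, one_mul]
  have h01 : (⟨i, by omega⟩ : Fin n) ≠ ⟨i+1, by omega⟩ := by simp
  by_cases h : (k : ℕ) = i ∨ (k : ℕ) = i + 1
  · rw [Fintype.sum_eq_add ⟨i, by omega⟩ ⟨i+1, by omega⟩ h01]
    · rcases h with h | h <;> simp [burauNat, h]
    · rintro x ⟨hx1, hx2⟩
      simp only [ne_eq, Fin.ext_iff] at hx1 hx2
      have : x ≠ k := by rw [ne_eq, Fin.ext_iff]; omega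
      simp [burauNat, hx1, hx2, this]
  · push Not at h
    rw [Fintype.sum_eq_single k]
    · simp [burauNat, h.1, h.2]
    · intro x hx
      simp [burauNat, h.1, h.2, hx]

theorem burauProd_colsum (n : ℕ) (q : ℂ) :
    (fun _ => 1) ᵥ* burauProd n q = fun _ => 1 := by
  rw [burauProd_eq_s18]
  have : ∀ k, k ≤ n - 1 → (fun _ => 1) ᵥ* ((List.range k).map (burauNat n q)).prod = fun _ => 1 := by
    intro k
    induction k with
    | zero => intro _; simp
    | succ k ih =>
      intro hk
      rw [List.range_succ, List.map_append, List.prod_append, ← vecMul_vecMul, ih (by omega)]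
      simpa using burauNat_colsum n q k (by omega)
  exact this _ le_rfl

theorem burauProd_row (n : ℕ) (q : ℂ) (j : ℕ) (hj : j + 1 < n) :
    (burauProd n q) ⟨j+1, hj⟩ = Pi.single ⟨j, by omega⟩ q := by
  rw [burauProd_eq_s18]
  have : ∀ k, k ≤ n - 1 → ((List.range k).map (burauNat n q)).prod ⟨j+1, hj⟩ =
     if j < k then Pi.single ⟨j, by omega⟩ q else Pi.single ⟨j+1, hj⟩ 1 := by
    intro k
    induction k with
    | zero => intro _; ext x; simp [Matrix.one_apply, Pi.single_apply, eq_comm]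
    | succ k ih =>
      intro hk
      ext x
      rw [List.range_succ, List.map_append, List.prod_append, Matrix.mul_apply, ih (by omega)]
      simp only [List.map_cons, List.map_nil, List.prod_cons, List.prod_nil, mul_one]
      by_cases h : j < k
      · rw [if_pos h, if_pos (by omega),
          Fintype.sum_eq_single ⟨j, by omega⟩ (fun y hy => by simp [hy])]
        simp only [Pi.single_eq_same, Pi.single_apply, burauNat, Fin.ext_iff]
        split_ifs <;> first | omega | simp
      · rw [if_neg h, Fintype.sum_eq_single ⟨j+1, hj⟩ (fun y hy => by simp [hy])]
        by_cases h' : j < k + 1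
        · rw [if_pos h']
          simp only [Pi.single_eq_same, Pi.single_apply, burauNat, Fin.ext_iff]
          split_ifs <;> first | omega | simp
        · rw [if_neg h']
          simp only [Pi.single_eq_same, Pi.single_apply, burauNat, Fin.ext_iff]
          split_ifs <;> first | omega | simp
  rw [this _ le_rfl, if_pos (by omega)]

theorem kron_mul {n : ℕ} (A B : Matrix (Fin n) (Fin n) ℂ) (r : ℕ) :
    kroneckerPow (A * B) r = kroneckerPow A r * kroneckerPow B r := by
  ext v w
  simp only [kroneckerPow, Matrix.mul_apply, Fintype.prod_sum, Finset.prod_mul_distrib]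

theorem kron_one {n : ℕ} (r : ℕ) :
    kroneckerPow (1 : Matrix (Fin n) (Fin n) ℂ) r = 1 := by
  ext v w
  simp only [kroneckerPow, Matrix.one_apply, Finset.prod_ite_zero, Finset.prod_const_one, funext_iff]
  simp

theorem det_kron_tri {n : ℕ} (L : Matrix (Fin n) (Fin n) ℂ) (r : ℕ) (s : ℂ)
    (hL : ∀ i j, i < j → L i j = 0) :
    (1 - s • kroneckerPow L r).det = ∏ v : Fin r → Fin n, (1 - s * ∏ i, L (v i) (v i)) := by
  have h := Matrix.det_of_isLowerTriangular
    ((1 - s • kroneckerPow L r).submatrix (ofLex : Lex (Fin r → Fin n) ≃ _) ofLex) (by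
      intro v w hvw
      have hvw : v < w := hvw
      have h1 : ∃ i, ofLex v i < ofLex w i := by
        by_contra hc
        push Not at hc
        exact absurd (Pi.toLex_monotone (show ofLex w ≤ ofLex v from hc)) (not_le.2 hvw)
      obtain ⟨i, hi⟩ := h1
      have h2 : kroneckerPow L r (ofLex v) (ofLex w) = 0 :=
        Finset.prod_eq_zero (Finset.mem_univ i) (hL _ _ hi)
      have h3 : ofLex v ≠ ofLex w := fun h => hi.ne (congrFun h i)
      simp [h2, h3])
  rw [Matrix.det_submatrix_equiv_self] at h
  rw [h, ← (ofLex : Lex (Fin r → Fin n) ≃ _).prod_comp]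
  simp [kroneckerPow]

theorem det_kron_conj {n : ℕ} (F A : Matrix (Fin n) (Fin n) ℂ) (hF : IsUnit F.det) (r : ℕ) (s : ℂ) :
    (1 - s • kroneckerPow (F⁻¹ * A * F) r).det = (1 - s • kroneckerPow A r).det := by
  have h1 : kroneckerPow F⁻¹ r * kroneckerPow F r = 1 := by
    rw [← kron_mul, Matrix.nonsing_inv_mul _ hF, kron_one]
  rw [kron_mul, kron_mul]
  have : 1 - s • (kroneckerPow F⁻¹ r * kroneckerPow A r * kroneckerPow F r) =
     kroneckerPow F⁻¹ r * (1 - s • kroneckerPow A r) * kroneckerPow F r := by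
    rw [mul_sub, sub_mul, mul_one, h1]; simp
  rw [this, det_mul_right_comm, h1, one_mul]

theorem det_kron_main (n : ℕ) [NeZero n] (A : Matrix (Fin n) (Fin n) ℂ) (η : ℂ) (hη : IsPrimitiveRoot η n)
    (d : Fin n → ℂ) (h0 : d 0 = 1) (hcol : (fun _ => 1) ᵥ* A = fun _ => 1)
    (hA : ∀ j : Fin n, j ≠ 0 → A *ᵥ (fun k => (η ^ (j:ℕ)) ^ (k:ℕ)) = d j • (fun k : Fin n => (η ^ (j:ℕ)) ^ (k:ℕ))) :
    A.det = ∏ j, d j ∧ ∀ (r : ℕ) (s : ℂ),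
    (1 - s • kroneckerPow A r).det = ∏ v : Fin r → Fin n, (1 - s * ∏ i, d (v i)) := by
  set F : Matrix (Fin n) (Fin n) ℂ := (vandermonde (fun j : Fin n => η ^ (j:ℕ)))ᵀ with hFdef
  have hF : IsUnit F.det := by
    rw [isUnit_iff_ne_zero, hFdef, det_transpose, det_vandermonde_ne_zero_iff]
    intro i j hij
    exact Fin.ext (hη.pow_inj i.2 j.2 hij)
  have hFcol : ∀ j : Fin n, F *ᵥ Pi.single j 1 = (fun k : Fin n => (η ^ (j:ℕ)) ^ (k:ℕ)) := by
    intro j; ext k; simp [F, vandermonde_apply]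
  have hLcol : ∀ j, j ≠ 0 → (F⁻¹ * A * F) *ᵥ Pi.single j 1 = d j • Pi.single j 1 := by
    intro j hj
    rw [← mulVec_mulVec, ← mulVec_mulVec, hFcol, hA j hj, mulVec_smul, ← hFcol, mulVec_mulVec,
      nonsing_inv_mul _ hF, one_mulVec]
  have hL : ∀ i j, j ≠ 0 → (F⁻¹ * A * F) i j = if i = j then d j else 0 := by
    intro i j hj
    have := congrFun (hLcol j hj) i
    simpa [Pi.single_apply] using this
  have hrow : (fun _ => 1) ᵥ* F = (n : ℂ) • Pi.single 0 1 := by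
    ext j
    simp only [vecMul, dotProduct, one_mul, F, transpose_apply, vandermonde_apply]
    by_cases hj : j = 0
    · subst hj; simp
    · have hne : η ^ (j:ℕ) ≠ 1 := hη.pow_ne_one_of_pos_of_lt (fun h => hj (Fin.ext h)) j.2
      have : (∑ x ∈ Finset.range n, (η ^ (j:ℕ)) ^ x) = 0 := by
        have h := mul_geom_sum (η ^ (j:ℕ)) n
        rw [← pow_mul, mul_comm (j:ℕ), pow_mul, hη.pow_eq_one, one_pow, sub_self] at h
        exact (mul_eq_zero.1 h).resolve_left (sub_ne_zero.2 hne)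
      rw [← Fin.sum_univ_eq_sum_range] at this
      simp [this, hj]
  have hL0 : (F⁻¹ * A * F) 0 0 = 1 := by
    have h1 : ((n : ℂ) • Pi.single 0 1) ᵥ* (F⁻¹ * A * F) = ((n : ℂ) • Pi.single 0 1) := by
      rw [← hrow, ← vecMul_vecMul, ← vecMul_vecMul, vecMul_vecMul _ F, mul_nonsing_inv _ hF, vecMul_one,
        hcol]
    have := congrFun h1 0
    have hn : (n : ℂ) ≠ 0 := NeZero.ne _
    simpa [smul_vecMul, hn] using this
  have htri : ∀ i j, i < j → (F⁻¹ * A * F) i j = 0 := by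
    intro i j hij
    rw [hL i j (by rintro rfl; simp at hij), if_neg hij.ne]
  have hdiag : ∀ i, (F⁻¹ * A * F) i i = d i := by
    intro i
    by_cases hi : i = 0
    · subst hi; rw [hL0, h0]
    · rw [hL i i hi, if_pos rfl]
  constructor
  · have := Matrix.det_of_isLowerTriangular (F⁻¹ * A * F) (fun i j hij => htri i j hij)
    simp_rw [hdiag] at this
    rw [← this, det_mul_right_comm, nonsing_inv_mul _ hF, one_mul]
  · intro r s
    rw [← det_kron_conj F A hF, det_kron_tri _ _ _ htri]
    simp_rw [hdiag]

theorem burau_eig (n : ℕ) [NeZero n] (q x : ℂ) (hx : x ^ n = 1) (hx1 : x ≠ 1) :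
    burauProd n q *ᵥ (fun k => x ^ (k:ℕ)) = (q * x⁻¹) • (fun k : Fin n => x ^ (k:ℕ)) := by
  have hx0 : x ≠ 0 := by rintro rfl; simp [NeZero.ne n] at hx
  have hg : ∑ k : Fin n, x ^ (k : ℕ) = 0 := by
    rw [Fin.sum_univ_eq_sum_range (fun k => x ^ k)]
    have h := mul_geom_sum x n
    rw [hx, sub_self] at h
    exact (mul_eq_zero.1 h).resolve_left (sub_ne_zero.2 hx1)
  have hsucc : ∀ k : Fin n, k ≠ 0 → (burauProd n q *ᵥ (fun k => x ^ (k:ℕ))) k = (q * x⁻¹) * x ^ (k:ℕ) := by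
    rintro ⟨k, hk⟩ h0
    obtain ⟨j, rfl⟩ : ∃ j, k = j + 1 := Nat.exists_eq_succ_of_ne_zero (by simpa [Fin.ext_iff] using h0)
    rw [mulVec, burauProd_row, single_dotProduct]
    simp only [pow_succ]
    field_simp
  have hsum : ∑ k, (burauProd n q *ᵥ (fun k => x ^ (k:ℕ))) k = 0 := by
    have : (fun _ => 1) ⬝ᵥ (burauProd n q *ᵥ (fun k => x ^ (k:ℕ))) = 0 := by
      rw [dotProduct_mulVec, burauProd_colsum]
      simpa [dotProduct] using hg
    simpa [dotProduct] using this
  ext k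
  by_cases hk : k = 0
  · subst hk
    rw [← Finset.add_sum_erase _ _ (Finset.mem_univ (0 : Fin n)),
      Finset.sum_congr rfl (fun j hj => hsucc j (Finset.ne_of_mem_erase hj)), ← Finset.mul_sum] at hsum
    rw [← Finset.add_sum_erase _ _ (Finset.mem_univ (0 : Fin n))] at hg
    rw [Pi.smul_apply, smul_eq_mul]
    linear_combination hsum - q * x⁻¹ * hg
  · exact hsucc k hk

theorem zpow_eig {n : ℕ} (A : Matrix (Fin n) (Fin n) ℂ) (hA : IsUnit A.det) (x : ℂ) (hx : x ≠ 0) (u : Fin n → ℂ)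
    (h : A *ᵥ u = x • u) (m : ℤ) : (A ^ m) *ᵥ u = x ^ m • u := by
  have hnat : ∀ k : ℕ, (A ^ k) *ᵥ u = x ^ k • u := by
    intro k
    induction k with
    | zero => simp
    | succ k ih => rw [pow_succ, ← mulVec_mulVec, h, mulVec_smul, ih, smul_smul, pow_succ, mul_comm]
  cases m with
  | ofNat k => simpa using hnat k
  | negSucc k =>
    rw [zpow_negSucc, zpow_negSucc]
    have hu : IsUnit (A ^ (k+1)).det := by rw [det_pow]; exact hA.pow _
    have h1 : (A ^ (k+1))⁻¹ *ᵥ ((A ^ (k+1)) *ᵥ u) = u := by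
      rw [mulVec_mulVec, nonsing_inv_mul _ hu, one_mulVec]
    rw [hnat, mulVec_smul] at h1
    rw [eq_inv_smul_iff₀ (pow_ne_zero _ hx), h1]

theorem zpow_col {n : ℕ} (A : Matrix (Fin n) (Fin n) ℂ) (hA : IsUnit A.det)
    (h : (fun _ => 1) ᵥ* A = fun _ => 1) (m : ℤ) : (fun _ => 1) ᵥ* (A ^ m) = fun _ => 1 := by
  have := zpow_eig Aᵀ (by rwa [det_transpose]) 1 one_ne_zero (fun _ => 1) (by rw [mulVec_transpose, h, one_smul]) m
  rwa [← transpose_zpow, mulVec_transpose, _root_.one_zpow, one_smul] at this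

theorem pascal_sum (r : ℕ) (h : ℕ → ℤ) :
    ∑ l ∈ Finset.range (r + 1 + 1), ((r + 1).choose l : ℤ) * h l =
    ∑ l ∈ Finset.range (r + 1), (r.choose l : ℤ) * h l +
    ∑ l ∈ Finset.range (r + 1), (r.choose l : ℤ) * h (l + 1) := by
  rw [Finset.sum_range_succ']
  have h1 : ∑ l ∈ Finset.range (r + 1), (r.choose l : ℤ) * h l =
      ∑ l ∈ Finset.range (r + 1), (r.choose (l + 1) : ℤ) * h (l + 1) + h 0 := by
    have := Finset.sum_range_succ' (fun l => (r.choose l : ℤ) * h l) (r + 1)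
    rw [Finset.sum_range_succ] at this
    simpa using this
  rw [h1]
  simp only [Nat.choose_succ_succ, Nat.cast_add, add_mul, Finset.sum_add_distrib]
  simp
  ring

theorem count_aux (n : ℕ) [NeZero n] (r : ℕ) : ∀ f : ℕ → Fin n → ℤ,
    (n : ℤ) * ∑ v : Fin r → Fin n, f (∑ i, if v i = 0 then 0 else 1) (∑ i, v i) =
    ∑ l ∈ Finset.range (r + 1), (r.choose l : ℤ) *
      ((((n : ℤ) - 1) ^ l - (-1) ^ l) * ∑ k, f l k + n * (-1) ^ l * f l 0) := by
  induction r with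
  | zero => intro f; simp
  | succ r ih =>
    intro f
    rw [← (Fin.consEquiv (fun _ : Fin (r+1) => Fin n)).sum_comp, Fintype.sum_prod_type]
    have h1 : ∀ j : Fin n, ∑ y : Fin r → Fin n,
        f (∑ i, if (Fin.consEquiv (fun _ : Fin (r+1) => Fin n)) (j, y) i = 0 then 0 else 1)
          (∑ i, (Fin.consEquiv (fun _ : Fin (r+1) => Fin n)) (j, y) i) =
        if j = 0 then ∑ y : Fin r → Fin n, f (∑ i, if y i = 0 then 0 else 1) (∑ i, y i)
        else ∑ y : Fin r → Fin n, (fun l k => f (l+1) (j + k)) (∑ i, if y i = 0 then 0 else 1) (∑ i, y i) := by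
      intro j
      split_ifs with h
      · subst h
        simp [Fin.consEquiv, Fin.sum_univ_succ]
      · simp [Fin.consEquiv, Fin.sum_univ_succ, h, add_comm]
    simp_rw [h1]
    rw [Finset.mul_sum]
    have h2 : ∀ j : Fin n, (n : ℤ) * (if j = 0 then ∑ y : Fin r → Fin n, f (∑ i, if y i = 0 then 0 else 1) (∑ i, y i)
        else ∑ y : Fin r → Fin n, (fun l k => f (l+1) (j + k)) (∑ i, if y i = 0 then 0 else 1) (∑ i, y i)) =
        if j = 0 then ∑ l ∈ Finset.range (r + 1), (r.choose l : ℤ) *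
      ((((n : ℤ) - 1) ^ l - (-1) ^ l) * ∑ k, f l k + n * (-1) ^ l * f l 0) else
       ∑ l ∈ Finset.range (r + 1), (r.choose l : ℤ) *
      ((((n : ℤ) - 1) ^ l - (-1) ^ l) * ∑ k, f (l+1) k + n * (-1) ^ l * f (l+1) j) := by
      intro j
      rw [mul_ite, ih, ih (fun l k => f (l+1) (j + k))]
      have : ∀ l, ∑ k, f l (j + k) = ∑ k, f l k := fun l => Equiv.sum_comp (Equiv.addLeft j) (f l)
      simp [this]
    simp_rw [h2]
    rw [← Finset.add_sum_erase _ _ (Finset.mem_univ (0 : Fin n)), if_pos rfl,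
      Finset.sum_congr rfl (fun j hj => if_neg (Finset.ne_of_mem_erase hj)), Finset.sum_comm]
    have h3 : ∀ l, ∑ j ∈ Finset.univ.erase (0 : Fin n), (r.choose l : ℤ) *
      ((((n : ℤ) - 1) ^ l - (-1) ^ l) * ∑ k, f (l+1) k + n * (-1) ^ l * f (l+1) j) =
      (r.choose l : ℤ) *
      ((((n : ℤ) - 1) ^ (l+1) - (-1) ^ (l+1)) * ∑ k, f (l+1) k + n * (-1) ^ (l+1) * f (l+1) 0) := by
      intro l
      rw [← Finset.mul_sum, Finset.sum_add_distrib, Finset.sum_const, ← Finset.mul_sum,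
        Finset.card_erase_of_mem (Finset.mem_univ _), Finset.card_univ, Fintype.card_fin,
        ← Finset.add_sum_erase Finset.univ (f (l+1)) (Finset.mem_univ (0 : Fin n)), nsmul_eq_mul,
        Nat.cast_sub (NeZero.one_le)]
      push_cast
      ring
    simp_rw [h3]
    exact (pascal_sum r (fun l => ((((n : ℤ) - 1) ^ l - (-1) ^ l) * ∑ k, f l k + n * (-1) ^ l * f l 0))).symm

theorem count_eq (n : ℕ) [NeZero n] (r : ℕ) (b : ℕ → ℕ)
    (hb : ∀ l, (b l : ℤ) * n = (r.choose l : ℤ) * (((n : ℤ) - 1) ^ l - (-1) ^ l))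
    (l : ℕ) (hl : l ≤ r) (k : Fin n) :
    ((Finset.univ.filter (fun v : Fin r → Fin n =>
      ((∑ i, if v i = 0 then 0 else 1), ∑ i, v i) = (l, k))).card : ℤ) =
    b l + if k = 0 then (-1) ^ l * (r.choose l : ℤ) else 0 := by
  have h := count_aux n r (fun l' k' => if (l', k') = (l, k) then 1 else 0)
  rw [Finset.sum_boole] at h
  have hn : (n : ℤ) ≠ 0 := Nat.cast_ne_zero.2 (NeZero.ne n)
  apply mul_left_cancel₀ hn
  rw [h, Finset.sum_eq_single_of_mem l (Finset.mem_range.2 (by omega))]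
  · have h0 : (0 = k) = (k = 0) := propext eq_comm
    simp only [Prod.mk.injEq, true_and, Finset.sum_ite_eq', Finset.mem_univ, if_true, h0]
    rw [mul_add, mul_add, mul_comm _ (b l : ℤ), hb]
    split_ifs <;> ring
  · intro l' _ hl'
    simp [hl']

theorem prod_root (n : ℕ) [NeZero n] (ζ x : ℂ) (hζ : IsPrimitiveRoot ζ n) :
    ∏ k : Fin n, (1 - x * ζ ^ (k : ℕ)) = 1 - x ^ n := by
  have h := hζ.pow_sub_pow_eq_prod_sub_mul 1 x (NeZero.pos n)
  rw [one_pow] at h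
  rw [h]
  refine Finset.prod_bij (fun k _ => ζ ^ (k : ℕ)) ?_ ?_ ?_ ?_
  · intro k _
    rw [Polynomial.mem_nthRootsFinset (NeZero.pos n), ← pow_mul, mul_comm, pow_mul, hζ.pow_eq_one, one_pow]
  · intro i _ j _ hij
    exact Fin.ext (hζ.pow_inj i.2 j.2 hij)
  · intro y hy
    rw [Polynomial.mem_nthRootsFinset (NeZero.pos n)] at hy
    obtain ⟨i, hi, rfl⟩ := hζ.eq_pow_of_pow_eq_one hy
    exact ⟨⟨i, hi⟩, Finset.mem_univ _, rfl⟩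
  · intro k _
    rw [mul_comm]

theorem prod_d (n : ℕ) [NeZero n] (Q ζ : ℂ) (hζ : ζ ^ n = 1) (r : ℕ) : ∀ (v : Fin r → Fin n),
    ∏ i, (if v i = 0 then 1 else Q * ζ ^ (v i : ℕ)) =
    Q ^ (∑ i, if v i = 0 then 0 else 1) * ζ ^ ((∑ i, v i : Fin n) : ℕ) := by
  have hadd : ∀ a b : Fin n, ζ ^ ((a + b : Fin n) : ℕ) = ζ ^ (a : ℕ) * ζ ^ (b : ℕ) := by
    intro a b
    rw [Fin.val_add, ← pow_eq_pow_mod _ hζ, pow_add]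
  induction r with
  | zero => intro v; simp
  | succ r ih =>
    intro v
    rw [Fin.prod_univ_succ, Fin.sum_univ_succ, Fin.sum_univ_succ, ih (fun i => v i.succ), hadd]
    split_ifs with h
    · simp [h]
    · ring

theorem final_prod (n : ℕ) [NeZero n] (r : ℕ) (b : ℕ → ℕ)
    (hb : ∀ l, (b l : ℤ) * n = (r.choose l : ℤ) * (((n : ℤ) - 1) ^ l - (-1) ^ l))
    (Q ζ s : ℂ) (hζ : IsPrimitiveRoot ζ n) :
    (∏ v : Fin r → Fin n, (1 - s * ∏ i, (if v i = 0 then 1 else Q * ζ ^ (v i : ℕ)))) *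
      ∏ l ∈ (Finset.range (r + 1)).filter (fun l => Odd l), (1 - Q ^ l * s) ^ (r.choose l)
    = (∏ l ∈ (Finset.range (r + 1)).filter (fun l => Even l), (1 - Q ^ l * s) ^ (r.choose l)) *
      ∏ l ∈ Finset.Icc 1 r, (1 - (Q ^ l) ^ n * s ^ n) ^ (b l) := by
  have hb0 : b 0 = 0 := by
    have := hb 0
    simp [NeZero.ne n] at this
    exact this
  have hIcc : ∏ l ∈ Finset.Icc 1 r, (1 - (Q ^ l) ^ n * s ^ n) ^ (b l) =
      ∏ l ∈ Finset.range (r + 1), (1 - (Q ^ l) ^ n * s ^ n) ^ (b l) := by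
    rw [Finset.prod_range_succ', hb0, pow_zero, mul_one, Finset.range_eq_Ico,
      Finset.prod_Ico_add' (fun l => (1 - (Q ^ l) ^ n * s ^ n) ^ (b l)) 0 r 1]
    rfl
  rw [hIcc]
  simp_rw [prod_d n Q ζ hζ.pow_eq_one]
  have hfib : (∏ v : Fin r → Fin n, (1 - s * (Q ^ (∑ i, if v i = 0 then 0 else 1) * ζ ^ ((∑ i, v i : Fin n) : ℕ)))) =
      ∏ l ∈ Finset.range (r + 1), ∏ k : Fin n, (1 - s * (Q ^ l * ζ ^ (k : ℕ))) ^
        (Finset.univ.filter (fun v : Fin r → Fin n =>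
      ((∑ i, if v i = 0 then 0 else 1), ∑ i, v i) = (l, k))).card := by
    rw [← Finset.prod_product', ← Finset.prod_fiberwise_of_maps_to
      (s := Finset.univ) (t := Finset.range (r + 1) ×ˢ Finset.univ)
      (g := fun v : Fin r → Fin n => ((∑ i, if v i = 0 then 0 else 1), ∑ i, v i))]
    · apply Finset.prod_congr rfl
      rintro ⟨l, k⟩ _
      apply Finset.prod_eq_pow_card
      intro v hv
      have := (Finset.mem_filter.1 hv).2
      simp only [Prod.mk.injEq] at this
      rw [this.1, this.2]
    · intro v _
      simp only [Finset.mem_product, Finset.mem_range, Finset.mem_univ, and_true]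
      have : (∑ i, if v i = 0 then 0 else 1) ≤ ∑ i : Fin r, 1 :=
        Finset.sum_le_sum (fun i _ => by split_ifs <;> simp)
      simp at this ⊢
      omega
  rw [hfib, Finset.prod_filter, Finset.prod_filter, ← Finset.prod_mul_distrib, ← Finset.prod_mul_distrib]
  apply Finset.prod_congr rfl
  intro l hl
  have hl : l ≤ r := by simpa [Nat.lt_succ_iff] using hl
  have hc := count_eq n r b hb l hl
  generalize hM : (fun k : Fin n => (Finset.univ.filter (fun v : Fin r → Fin n =>
      ((∑ i, if v i = 0 then 0 else 1), ∑ i, v i) = (l, k))).card) = M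
  have hM' := fun k => congrFun hM k
  simp_rw [hM'] at hc ⊢
  have hroot : ∏ k : Fin n, (1 - s * (Q ^ l * ζ ^ (k : ℕ))) = 1 - (Q ^ l) ^ n * s ^ n := by
    rw [← mul_pow, ← prod_root n ζ (Q ^ l * s) hζ]
    exact Finset.prod_congr rfl (fun k _ => by ring)
  have herase : ∀ k ∈ Finset.univ.erase (0 : Fin n), (1 - s * (Q ^ l * ζ ^ (k : ℕ))) ^ M k =
      (1 - s * (Q ^ l * ζ ^ (k : ℕ))) ^ b l := by
    intro k hk
    have := hc k
    rw [if_neg (Finset.ne_of_mem_erase hk), add_zero] at this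
    rw [Nat.cast_inj.1 this]
  have h0 := hc 0
  rw [if_pos rfl] at h0
  rw [← hroot, ← Finset.prod_pow, ← Finset.mul_prod_erase _ _ (Finset.mem_univ (0 : Fin n)),
    Finset.prod_congr rfl herase, ← Finset.mul_prod_erase _ (fun k : Fin n => (1 - s * (Q ^ l * ζ ^ (k : ℕ))) ^ b l)
      (Finset.mem_univ (0 : Fin n))]
  have hs : 1 - s * (Q ^ l * ζ ^ ((0 : Fin n) : ℕ)) = 1 - Q ^ l * s := by simp [mul_comm]
  rw [hs]
  rcases Nat.even_or_odd l with h | h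
  · rw [if_neg (Nat.not_odd_iff_even.2 h), if_pos h]
    rw [h.neg_one_pow, one_mul] at h0
    have h0 : M 0 = b l + r.choose l := by exact_mod_cast h0
    rw [h0, pow_add]
    ring
  · rw [if_pos h, if_neg (Nat.not_even_iff_odd.2 h)]
    rw [h.neg_one_pow] at h0
    have h0 : b l = M 0 + r.choose l := by
      have : (b l : ℤ) = M 0 + r.choose l := by linarith
      exact_mod_cast this
    rw [h0, pow_add]
    ring

/-- **Zeta function of tensor powers of the Burau representation at a torus braid.**
For `gcd(n, r!·|m|) = 1` and `b_{r,l,n} = C(r,l)·((n−1)^l − (−1)^l)/n ∈ ℕ`,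
`det(I_{n^r} − s·T_{n,m}^{⊗r}) · ∏_{1≤l≤r, odd} (1 − q^{lm}s)^{C(r,l)}
  = ∏_{0≤l≤r, even} (1 − q^{lm}s)^{C(r,l)} · ∏_{l=1}^{r} (1 − q^{lmn}s^n)^{b_{r,l,n}}`,
i.e. `ζ(s, σ_{n,m}; β_{n,q}^{⊗r}) = ∏_{l=0}^{r} (1−q^{lm}s)^{−a_{r,l}} (1−q^{lmn}s^n)^{−b_{r,l,n}}`
with `a_{r,l} = (−1)^l C(r,l)`. -/
theorem torus_braid_tensor_power_zeta (n : ℕ) (hn : 2 ≤ n) (r : ℕ) (hr : 1 ≤ r)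
    (m : ℤ) (hnm : Nat.Coprime n (r.factorial * m.natAbs))
    (b : ℕ → ℕ)
    (hb : ∀ l, (b l : ℤ) * n = (r.choose l : ℤ) * (((n : ℤ) - 1) ^ l - (-1) ^ l))
    (q : ℂ) (hq : q ≠ 0) (s : ℂ) :
    ((1 : Matrix (Fin r → Fin n) (Fin r → Fin n) ℂ)
        - s • kroneckerPow (torusBurau n q m) r).det *
      ∏ l ∈ (Finset.range (r + 1)).filter (fun l => Odd l),
        (1 - q ^ ((l : ℤ) * m) * s) ^ (r.choose l)
    = (∏ l ∈ (Finset.range (r + 1)).filter (fun l => Even l),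
        (1 - q ^ ((l : ℤ) * m) * s) ^ (r.choose l)) *
      ∏ l ∈ Finset.Icc 1 r,
        (1 - q ^ ((l : ℤ) * m * n) * s ^ n) ^ (b l) := by
  have : NeZero n := ⟨by omega⟩
  obtain ⟨η, hη⟩ : ∃ η : ℂ, IsPrimitiveRoot η n := ⟨_, Complex.isPrimitiveRoot_exp n (by omega)⟩
  have hη0 : η ≠ 0 := hη.ne_zero (by omega)
  have hP : ∀ j : Fin n, j ≠ 0 → burauProd n q *ᵥ (fun k => (η ^ (j:ℕ)) ^ (k:ℕ)) =
      (q * (η ^ (j:ℕ))⁻¹) • (fun k : Fin n => (η ^ (j:ℕ)) ^ (k:ℕ)) := by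
    intro j hj
    apply burau_eig
    · rw [← pow_mul, mul_comm, pow_mul, hη.pow_eq_one, one_pow]
    · exact hη.pow_ne_one_of_pos_of_lt (fun h => hj (Fin.ext h)) j.2
  have hdet : IsUnit (burauProd n q).det := by
    have := (det_kron_main n (burauProd n q) η hη
      (fun j => if j = 0 then 1 else q * (η ^ (j:ℕ))⁻¹) (by simp) (burauProd_colsum n q)
      (fun j hj => by simpa only [if_neg hj] using hP j hj)).1
    rw [this, isUnit_iff_ne_zero, Finset.prod_ne_zero_iff]
    intro j _
    split_ifs
    · exact one_ne_zero
    · exact mul_ne_zero hq (inv_ne_zero (pow_ne_zero _ hη0))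
  have hζ : IsPrimitiveRoot (η ^ (-m)) n := by
    apply hη.zpow_of_gcd_eq_one
    have : Nat.Coprime n m.natAbs := Nat.Coprime.coprime_mul_left_right hnm
    simpa [Int.gcd, Nat.Coprime] using this.symm
  have hmain := (det_kron_main n (torusBurau n q m) η hη
      (fun j => if j = 0 then 1 else q ^ m * (η ^ (-m)) ^ (j:ℕ)) (by simp)
      (zpow_col _ hdet (burauProd_colsum n q) m)
      (fun j hj => by
        have h := zpow_eig _ hdet _ (mul_ne_zero hq (inv_ne_zero (pow_ne_zero (j:ℕ) hη0))) _ (hP j hj) m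
        have h2 : q ^ m * (η ^ (-m)) ^ (j:ℕ) = (q * (η ^ (j:ℕ))⁻¹) ^ m := by
          rw [_root_.mul_zpow, _root_.inv_zpow', ← _root_.zpow_natCast, ← _root_.zpow_natCast, ← _root_.zpow_mul, ← _root_.zpow_mul, mul_comm (-m)]
        rw [if_neg hj, h2]
        exact h)).2 r s
  rw [hmain]
  have h1 : ∀ l : ℕ, q ^ ((l : ℤ) * m) = (q ^ m) ^ l := fun l => by
    rw [mul_comm, _root_.zpow_mul, _root_.zpow_natCast]
  have h2 : ∀ l : ℕ, q ^ ((l : ℤ) * m * n) = ((q ^ m) ^ l) ^ n := fun l => by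
    rw [_root_.zpow_mul, h1, _root_.zpow_natCast]
  simp_rw [h1, h2]
  exact final_prod n r b hb (q ^ m) (η ^ (-m)) s hζ
end
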